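/- Suppose either (i) p11 > p01 and β ≤ 1/((3−ε)·(p11 − p01)), or (ii) p01 > p11 and β ≤ 1/((5−2ε)·(p01 − p11)). Then for every horizon T ≥ 1 the optimal finite-horizon single-arm policy is a threshold policy: there exists ω*_T ∈ ℝ such that for every ω ∈ [0,1], V_T(ω;u=1) > V_T(ω;u=0) if and only if ω > ω*_T. Moreover, if 0 ≤ m < 1−ε, the threshold can be chosen in [0,1] with V_T(ω*_T;u=1) = V_T(ω*_T;u=0). -/

import Mathlib

/-- One-step belief update without observation: `T(ω) = ω·p11 + (1−ω)·p01`. -/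
noncomputable def Tmap (p01 p11 ω : ℝ) : ℝ := ω * p11 + (1 - ω) * p01

/-- Belief update after a failed observation: `φ(ω) = εω/(εω + 1 − ω)`. -/
noncomputable def phi (ε ω : ℝ) : ℝ := ε * ω / (ε * ω + 1 - ω)

/-- Finite-horizon value function `V_T` of the single-armed bandit with subsidy `m`:
`V_0 ≡ 0` and `V_T(ω) = max{V_T(ω;u=1), V_T(ω;u=0)}`. -/
noncomputable def Vfin (p01 p11 ε β m : ℝ) : ℕ → ℝ → ℝ
  | 0, _ => 0
  | T + 1, ω =>
      max ((1 - ε) * ω + β * ((1 - ε) * ω * Vfin p01 p11 ε β m T p11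
            + (1 - (1 - ε) * ω) * Vfin p01 p11 ε β m T (Tmap p01 p11 (phi ε ω))))
          (m + β * Vfin p01 p11 ε β m T (Tmap p01 p11 ω))


/-- Active-branch finite-horizon value `V_T(ω;u=1)` (meaningful for `T ≥ 1`). -/
noncomputable def VfinAct (p01 p11 ε β m : ℝ) (T : ℕ) (ω : ℝ) : ℝ :=
  (1 - ε) * ω + β * ((1 - ε) * ω * Vfin p01 p11 ε β m (T - 1) p11
    + (1 - (1 - ε) * ω) * Vfin p01 p11 ε β m (T - 1) (Tmap p01 p11 (phi ε ω)))

/-- Passive-branch finite-horizon value `V_T(ω;u=0)` (meaningful for `T ≥ 1`). -/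
noncomputable def VfinPas (p01 p11 ε β m : ℝ) (T : ℕ) (ω : ℝ) : ℝ :=
  m + β * Vfin p01 p11 ε β m (T - 1) (Tmap p01 p11 ω)

/-- On `[0,1]`, every chord of `f` has slope between `s` and `S`. -/
def SlopeBounded (s S : ℝ) (f : ℝ → ℝ) : Prop :=
  ∀ x ∈ Set.Icc (0:ℝ) 1, ∀ y ∈ Set.Icc (0:ℝ) 1, x ≤ y →
    s * (y - x) ≤ f y - f x ∧ f y - f x ≤ S * (y - x)

namespace SlopeBounded

variable {s S : ℝ} {f : ℝ → ℝ}

theorem continuousOn (h : SlopeBounded s S f) : ContinuousOn f (Set.Icc 0 1) := by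
  have key : ∀ x ∈ Set.Icc (0:ℝ) 1, ∀ y ∈ Set.Icc (0:ℝ) 1, x ≤ y →
      |f y - f x| ≤ (|s| + |S|) * (y - x) := by
    intro x hx y hy hxy
    obtain ⟨h₁, h₂⟩ := h x hx y hy hxy
    have hd : 0 ≤ y - x := sub_nonneg.2 hxy
    rw [abs_le]
    constructor
    · nlinarith [neg_abs_le s, abs_nonneg S]
    · nlinarith [le_abs_self S, abs_nonneg s]
  have hL : LipschitzOnWith (Real.toNNReal (|s| + |S|)) f (Set.Icc 0 1) := by
    refine LipschitzOnWith.of_dist_le_mul fun x hx y hy => ?_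
    rw [Real.coe_toNNReal _ (by positivity), Real.dist_eq, Real.dist_eq]
    rcases le_total x y with hxy | hxy
    · rw [abs_sub_comm, abs_sub_comm x y, abs_of_nonneg (sub_nonneg.2 hxy)]
      exact key x hx y hy hxy
    · rw [abs_of_nonneg (sub_nonneg.2 hxy)]
      exact key y hy x hx hxy
  exact hL.continuousOn

theorem strictMonoOn (h : SlopeBounded s S f) (hs : 0 < s) :
    StrictMonoOn f (Set.Icc 0 1) := by
  intro x hx y hy hxy
  have := (h x hx y hy hxy.le).1
  have := mul_pos hs (sub_pos.2 hxy)
  linarith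

theorem max {g : ℝ → ℝ} {t U : ℝ} (hf : SlopeBounded s S f) (hg : SlopeBounded s S g)
    (ht : t ≤ s) (hU : S ≤ U) : SlopeBounded t U (fun x => max (f x) (g x)) := by
  intro x hx y hy hxy
  obtain ⟨f₁, f₂⟩ := hf x hx y hy hxy
  obtain ⟨g₁, g₂⟩ := hg x hx y hy hxy
  have hd : 0 ≤ y - x := sub_nonneg.2 hxy
  have ht' := mul_le_mul_of_nonneg_right ht hd
  have hU' := mul_le_mul_of_nonneg_right hU hd
  dsimp only
  constructor
  · rcases max_cases (f x) (g x) with ⟨h, -⟩ | ⟨h, -⟩ <;> rw [h]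
    · linarith [le_max_left (f y) (g y)]
    · linarith [le_max_right (f y) (g y)]
  · rcases max_cases (f y) (g y) with ⟨h, -⟩ | ⟨h, -⟩ <;> rw [h]
    · linarith [le_max_left (f x) (g x)]
    · linarith [le_max_right (f x) (g x)]

theorem weaken {t U : ℝ} (h : SlopeBounded s S f) (ht : t ≤ s) (hU : S ≤ U) :
    SlopeBounded t U f := by
  simpa using h.max h ht hU

theorem affine_comp {a b : ℝ} (h : SlopeBounded s S f) (hb : 0 ≤ b) :
    SlopeBounded (b * s) (b * S) (fun x => a + b * f x) := by
  intro x hx y hy hxy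
  obtain ⟨h₁, h₂⟩ := h x hx y hy hxy
  have := mul_le_mul_of_nonneg_left h₁ hb
  have := mul_le_mul_of_nonneg_left h₂ hb
  constructor <;> dsimp only <;> linarith

theorem sub {g : ℝ → ℝ} {t U : ℝ} (hf : SlopeBounded s S f) (hg : SlopeBounded t U g) :
    SlopeBounded (s - U) (S - t) (fun x => f x - g x) := by
  intro x hx y hy hxy
  obtain ⟨f₁, f₂⟩ := hf x hx y hy hxy
  obtain ⟨g₁, g₂⟩ := hg x hx y hy hxy
  constructor <;> dsimp only <;> linarith

end SlopeBounded

section Belief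

variable {p01 p11 ε : ℝ}

theorem Tmap_mem_Icc {ω : ℝ} (hp01 : p01 ∈ Set.Ioo (0:ℝ) 1) (hp11 : p11 ∈ Set.Ioo (0:ℝ) 1)
    (hω : ω ∈ Set.Icc (0:ℝ) 1) : Tmap p01 p11 ω ∈ Set.Icc (0:ℝ) 1 := by
  obtain ⟨a₀, a₁⟩ := hp01
  obtain ⟨b₀, b₁⟩ := hp11
  obtain ⟨w₀, w₁⟩ := hω
  unfold Tmap
  constructor <;> nlinarith

theorem Tmap_sub (x y : ℝ) : Tmap p01 p11 y - Tmap p01 p11 x = (p11 - p01) * (y - x) := by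
  unfold Tmap; ring

theorem failure_prob_pos {ω : ℝ} (hε : ε ∈ Set.Ioo (0:ℝ) 1) (hω : ω ∈ Set.Icc (0:ℝ) 1) :
    0 < 1 - (1 - ε) * ω := by
  obtain ⟨e₀, e₁⟩ := hε
  obtain ⟨w₀, w₁⟩ := hω
  nlinarith

theorem failure_prob_mul_phi {ω : ℝ} (hε : ε ∈ Set.Ioo (0:ℝ) 1) (hω : ω ∈ Set.Icc (0:ℝ) 1) :
    (1 - (1 - ε) * ω) * phi ε ω = ε * ω := by
  have h := (failure_prob_pos hε hω).ne'
  rw [phi, show ε * ω + 1 - ω = 1 - (1 - ε) * ω by ring]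
  field_simp

theorem phi_mem_Icc {ω : ℝ} (hε : ε ∈ Set.Ioo (0:ℝ) 1) (hω : ω ∈ Set.Icc (0:ℝ) 1) :
    phi ε ω ∈ Set.Icc (0:ℝ) 1 := by
  have h := failure_prob_pos hε hω
  rw [phi, show ε * ω + 1 - ω = 1 - (1 - ε) * ω by ring]
  obtain ⟨w₀, w₁⟩ := hω
  refine ⟨div_nonneg (mul_nonneg hε.1.le w₀) h.le, ?_⟩
  rw [div_le_one h]
  linarith

theorem phi_mono {x y : ℝ} (hε : ε ∈ Set.Ioo (0:ℝ) 1) (hx : x ∈ Set.Icc (0:ℝ) 1)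
    (hy : y ∈ Set.Icc (0:ℝ) 1) (hxy : x ≤ y) : phi ε x ≤ phi ε y := by
  have h₁ := failure_prob_pos hε hx
  have h₂ := failure_prob_pos hε hy
  rw [phi, phi, show ε * x + 1 - x = 1 - (1 - ε) * x by ring,
    show ε * y + 1 - y = 1 - (1 - ε) * y by ring, div_le_div_iff₀ h₁ h₂]
  linarith [mul_le_mul_of_nonneg_left hxy hε.1.le]

theorem phi_zero : phi ε 0 = 0 := by simp [phi]

theorem phi_one (hε : ε ∈ Set.Ioo (0:ℝ) 1) : phi ε 1 = 1 := by
  simp [phi, hε.1.ne']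

theorem SlopeBounded.comp_Tmap_of_le {s S : ℝ} {f : ℝ → ℝ} (h : SlopeBounded s S f)
    (hp01 : p01 ∈ Set.Ioo (0:ℝ) 1) (hp11 : p11 ∈ Set.Ioo (0:ℝ) 1) (hle : p01 ≤ p11) :
    SlopeBounded ((p11 - p01) * s) ((p11 - p01) * S) (fun x => f (Tmap p01 p11 x)) := by
  intro x hx y hy hxy
  have e := Tmap_sub (p01 := p01) (p11 := p11) x y
  have hm := mul_nonneg (sub_nonneg.2 hle) (sub_nonneg.2 hxy)
  have := h _ (Tmap_mem_Icc hp01 hp11 hx) _ (Tmap_mem_Icc hp01 hp11 hy) (by linarith)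
  rw [e] at this
  constructor <;> dsimp only <;> linarith

theorem SlopeBounded.comp_Tmap_of_ge {s S : ℝ} {f : ℝ → ℝ} (h : SlopeBounded s S f)
    (hp01 : p01 ∈ Set.Ioo (0:ℝ) 1) (hp11 : p11 ∈ Set.Ioo (0:ℝ) 1) (hle : p11 ≤ p01) :
    SlopeBounded ((p11 - p01) * S) ((p11 - p01) * s) (fun x => f (Tmap p01 p11 x)) := by
  intro x hx y hy hxy
  have e := Tmap_sub (p01 := p01) (p11 := p11) y x
  have hm := mul_nonneg (sub_nonneg.2 hle) (sub_nonneg.2 hxy)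
  have := h _ (Tmap_mem_Icc hp01 hp11 hy) _ (Tmap_mem_Icc hp01 hp11 hx) (by linarith)
  rw [e] at this
  constructor <;> dsimp only <;> linarith

/-- Averaging over the posterior belief (`1` after a success, `phi ε ω` after a failure)
preserves slope bounds, because the posterior has mean `ω`. -/
theorem SlopeBounded.posterior_average {s S : ℝ} {W : ℝ → ℝ} (h : SlopeBounded s S W)
    (hε : ε ∈ Set.Ioo (0:ℝ) 1) :
    SlopeBounded s S
      (fun ω => (1 - ε) * ω * W 1 + (1 - (1 - ε) * ω) * W (phi ε ω)) := by
  intro x hx y hy hxy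
  have hX := phi_mem_Icc hε hx
  have hY := phi_mem_Icc hε hy
  obtain ⟨a₁, a₂⟩ := h _ hX _ hY (phi_mono hε hx hy hxy)
  obtain ⟨b₁, b₂⟩ := h _ hY 1 (by simp) hY.2
  have hc : 0 ≤ (1 - ε) * (y - x) := mul_nonneg (by linarith [hε.2]) (by linarith)
  have hq := (failure_prob_pos hε hx).le
  have split : (1 - ε) * y * W 1 + (1 - (1 - ε) * y) * W (phi ε y)
      - ((1 - ε) * x * W 1 + (1 - (1 - ε) * x) * W (phi ε x))
      = (1 - ε) * (y - x) * (W 1 - W (phi ε y))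
        + (1 - (1 - ε) * x) * (W (phi ε y) - W (phi ε x)) := by ring
  have mean : (1 - ε) * (y - x) * (1 - phi ε y)
        + (1 - (1 - ε) * x) * (phi ε y - phi ε x) = y - x := by
    linear_combination failure_prob_mul_phi hε hy - failure_prob_mul_phi hε hx
  dsimp only
  rw [← mean, split]
  have := mul_le_mul_of_nonneg_left a₁ hq
  have := mul_le_mul_of_nonneg_left a₂ hq
  have := mul_le_mul_of_nonneg_left b₁ hc
  have := mul_le_mul_of_nonneg_left b₂ hc
  constructor <;> linarith

end Belief

section Bellman

variable {p01 p11 ε β m : ℝ}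

theorem Vfin_succ (n : ℕ) :
    Vfin p01 p11 ε β m (n + 1) =
      fun ω => max (VfinAct p01 p11 ε β m (n + 1) ω) (VfinPas p01 p11 ε β m (n + 1) ω) := by
  funext ω
  simp [Vfin, VfinAct, VfinPas]

theorem VfinPas_slopeBounded {lo hi : ℝ} {n : ℕ} (hβ : 0 ≤ β)
    (hW : SlopeBounded lo hi (fun x => Vfin p01 p11 ε β m n (Tmap p01 p11 x))) :
    SlopeBounded (β * lo) (β * hi) (VfinPas p01 p11 ε β m (n + 1)) :=
  hW.affine_comp hβ

theorem VfinAct_slopeBounded {lo hi : ℝ} {n : ℕ} (hβ : 0 ≤ β) (hε : ε ∈ Set.Ioo (0:ℝ) 1)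
    (hW : SlopeBounded lo hi (fun x => Vfin p01 p11 ε β m n (Tmap p01 p11 x))) :
    SlopeBounded ((1 - ε) + β * lo) ((1 - ε) + β * hi) (VfinAct p01 p11 ε β m (n + 1)) := by
  intro x hx y hy hxy
  have h := (hW.posterior_average hε).affine_comp (a := 0) hβ x hx y hy hxy
  have h1 : Tmap p01 p11 1 = p11 := by simp [Tmap]
  simp only [h1] at h
  simp only [VfinAct, Nat.add_sub_cancel]
  constructor <;> linarith [h.1, h.2]

/-- The advantage of the active branch has slopes bounded below by
`(1 - ε) + β * lo - β * hi`, as soon as `[s, S]` is an invariant range of slopes for the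
Bellman recursion and `[lo, hi]` is the range it induces after composing with `Tmap`. -/
theorem advantage_slopeBounded {s S lo hi : ℝ} (hβ : 0 ≤ β) (hε : ε ∈ Set.Ioo (0:ℝ) 1)
    (hs : s ≤ 0) (hS : 0 ≤ S)
    (hT : ∀ f, SlopeBounded s S f → SlopeBounded lo hi (fun x => f (Tmap p01 p11 x)))
    (hlo : s ≤ β * lo) (hhi : (1 - ε) + β * hi ≤ S) (n : ℕ) :
    SlopeBounded ((1 - ε) + β * lo - β * hi) ((1 - ε) + β * hi - β * lo)
      (fun ω => VfinAct p01 p11 ε β m (n + 1) ω - VfinPas p01 p11 ε β m (n + 1) ω) := by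
  have hε₁ : 0 ≤ 1 - ε := by linarith [hε.2]
  have hV : ∀ k, SlopeBounded s S (Vfin p01 p11 ε β m k) := by
    intro k
    induction k with
    | zero =>
      intro x _ y _ hxy
      have hd : 0 ≤ y - x := sub_nonneg.2 hxy
      simp only [Vfin, sub_self]
      exact ⟨mul_nonpos_of_nonpos_of_nonneg hs hd, mul_nonneg hS hd⟩
    | succ k ih =>
      rw [Vfin_succ]
      exact ((VfinAct_slopeBounded hβ hε (hT _ ih)).weaken
          (by linarith : β * lo ≤ _) le_rfl).max
        ((VfinPas_slopeBounded hβ (hT _ ih)).weaken le_rfl (by linarith)) hlo hhi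
  exact (VfinAct_slopeBounded hβ hε (hT _ (hV n))).sub (VfinPas_slopeBounded hβ (hT _ (hV n)))

theorem advantage_zero (n : ℕ) :
    VfinAct p01 p11 ε β m n 0 - VfinPas p01 p11 ε β m n 0 = -m := by
  simp [VfinAct, VfinPas, phi_zero]

theorem advantage_one (hε : ε ∈ Set.Ioo (0:ℝ) 1) (n : ℕ) :
    VfinAct p01 p11 ε β m n 1 - VfinPas p01 p11 ε β m n 1 = (1 - ε) - m := by
  simp only [VfinAct, VfinPas, phi_one hε, Tmap]
  ring_nf

theorem exists_slopeBounded_advantage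
    (hp01 : p01 ∈ Set.Ioo (0:ℝ) 1) (hp11 : p11 ∈ Set.Ioo (0:ℝ) 1)
    (hε : ε ∈ Set.Ioo (0:ℝ) 1) (hβ : β ∈ Set.Ioo (0:ℝ) 1) (hq : β * |p11 - p01| < 1 / 2)
    (n : ℕ) :
    ∃ s S, 0 < s ∧ SlopeBounded s S
      (fun ω => VfinAct p01 p11 ε β m (n + 1) ω - VfinPas p01 p11 ε β m (n + 1) ω) := by
  have hβ₀ := hβ.1.le
  have hc : 0 < 1 - ε := by linarith [hε.2]
  rcases le_total p01 p11 with hle | hle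
  · rw [abs_of_nonneg (sub_nonneg.2 hle)] at hq
    have hq₀ : 0 ≤ β * (p11 - p01) := mul_nonneg hβ₀ (sub_nonneg.2 hle)
    obtain ⟨S, hS⟩ : ∃ S, S * (1 - β * (p11 - p01)) = 1 - ε :=
      ⟨_, div_mul_cancel₀ _ (by linarith)⟩
    have hS₀ : 0 < S := pos_of_mul_pos_left (hS ▸ hc) (by linarith)
    refine ⟨_, _, ?_, advantage_slopeBounded hβ₀ hε le_rfl hS₀.le
      (fun f hf => hf.comp_Tmap_of_le hp01 hp11 hle) (by simp) (by linarith) n⟩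
    nlinarith
  · rw [abs_of_nonpos (sub_nonpos.2 hle)] at hq
    have hq₀ : 0 ≤ β * -(p11 - p01) := mul_nonneg hβ₀ (by linarith)
    obtain ⟨q, hqd⟩ : ∃ q, q = β * -(p11 - p01) := ⟨_, rfl⟩
    rw [← hqd] at hq hq₀
    obtain ⟨S, hS⟩ : ∃ S, S * (1 - q ^ 2) = 1 - ε :=
      ⟨_, div_mul_cancel₀ _ (by nlinarith)⟩
    have hS₀ : 0 < S := pos_of_mul_pos_left (hS ▸ hc) (by nlinarith)
    have e₁ : β * ((p11 - p01) * S) = -(q * S) := by rw [hqd]; ring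
    have e₂ : β * ((p11 - p01) * (-(q * S))) = q ^ 2 * S := by rw [hqd]; ring
    refine ⟨_, _, ?_, advantage_slopeBounded (s := -(q * S)) hβ₀ hε
      (neg_nonpos.2 (mul_nonneg hq₀ hS₀.le)) hS₀.le
      (fun f hf => hf.comp_Tmap_of_ge hp01 hp11 hle) (by rw [e₁]) (by rw [e₂]; linarith) n⟩
    rw [e₁, e₂, ← hS]
    have : 0 < S * ((1 + q) * (1 - 2 * q)) :=
      mul_pos hS₀ (mul_pos (by linarith) (by linarith))
    linarith

end Bellman

/-- A strictly increasing function with a zero at `w` is positive exactly to the right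
of `w`. -/
theorem StrictMonoOn.pos_iff_of_eq_zero {s : Set ℝ} {D : ℝ → ℝ} (hD : StrictMonoOn D s)
    {w x : ℝ} (hw : w ∈ s) (hx : x ∈ s) (h0 : D w = 0) : 0 < D x ↔ w < x := by
  rw [← h0, hD.lt_iff_lt hw hx]

/-- Under the stated conditions on `β`, the optimal finite-horizon single-arm
policy is a threshold policy: for every `T ≥ 1` there is a threshold `ω*_T ∈ ℝ`
with `V_T(ω;u=1) > V_T(ω;u=0)` iff `ω > ω*_T` on `[0,1]`; moreover if
`0 ≤ m < 1 − ε` the threshold can be chosen in `[0,1]`, where the two branch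
values are equal. -/
theorem threshold_policy_finite (p01 p11 ε β m : ℝ)
    (hp01 : p01 ∈ Set.Ioo (0:ℝ) 1) (hp11 : p11 ∈ Set.Ioo (0:ℝ) 1)
    (hne : p01 ≠ p11) (hε : ε ∈ Set.Ioo (0:ℝ) 1) (hβ : β ∈ Set.Ioo (0:ℝ) 1)
    (hcond : (p01 < p11 ∧ β ≤ 1 / ((3 - ε) * (p11 - p01))) ∨
             (p11 < p01 ∧ β ≤ 1 / ((5 - 2 * ε) * (p01 - p11)))) :
    ∀ T : ℕ, 1 ≤ T →
      (∃ ωstar : ℝ, ∀ ω ∈ Set.Icc (0:ℝ) 1,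
        VfinAct p01 p11 ε β m T ω > VfinPas p01 p11 ε β m T ω ↔ ω > ωstar) ∧
      (0 ≤ m → m < 1 - ε →
        ∃ ωstar ∈ Set.Icc (0:ℝ) 1,
          (∀ ω ∈ Set.Icc (0:ℝ) 1,
            VfinAct p01 p11 ε β m T ω > VfinPas p01 p11 ε β m T ω ↔ ω > ωstar) ∧
          VfinAct p01 p11 ε β m T ωstar = VfinPas p01 p11 ε β m T ωstar) := by
  intro T hT
  obtain ⟨n, rfl⟩ := Nat.exists_eq_add_of_le' hT
  have hq : β * |p11 - p01| < 1 / 2 := by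
    obtain ⟨e₀, e₁⟩ := hε
    have hβ₀ := hβ.1
    rcases hcond with ⟨hlt, h⟩ | ⟨hlt, h⟩
    · rw [abs_of_pos (sub_pos.2 hlt)]
      rw [le_div_iff₀ (mul_pos (by linarith) (sub_pos.2 hlt))] at h
      nlinarith [mul_pos hβ₀ (sub_pos.2 hlt)]
    · rw [abs_sub_comm, abs_of_pos (sub_pos.2 hlt)]
      rw [le_div_iff₀ (mul_pos (by linarith) (sub_pos.2 hlt))] at h
      nlinarith [mul_pos hβ₀ (sub_pos.2 hlt)]
  obtain ⟨s, S, hs, hD⟩ := exists_slopeBounded_advantage (m := m) hp01 hp11 hε hβ hq n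
  have hmono := hD.strictMonoOn hs
  have h0 := advantage_zero (p01 := p01) (p11 := p11) (ε := ε) (β := β) (m := m) (n + 1)
  have h1 := advantage_one (p01 := p01) (p11 := p11) (β := β) (m := m) hε (n + 1)
  have mem0 : (0:ℝ) ∈ Set.Icc (0:ℝ) 1 := by simp
  have mem1 : (1:ℝ) ∈ Set.Icc (0:ℝ) 1 := by simp
  have interior : 0 ≤ m → m < 1 - ε →
      ∃ ωstar ∈ Set.Icc (0:ℝ) 1,
        (∀ ω ∈ Set.Icc (0:ℝ) 1,
          VfinAct p01 p11 ε β m (n + 1) ω > VfinPas p01 p11 ε β m (n + 1) ω ↔ ω > ωstar) ∧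
        VfinAct p01 p11 ε β m (n + 1) ωstar = VfinPas p01 p11 ε β m (n + 1) ωstar := by
    intro hm₀ hm₁
    obtain ⟨w, hw, hw0⟩ := intermediate_value_Icc zero_le_one hD.continuousOn
      (show (0:ℝ) ∈ Set.Icc _ _ from ⟨by linarith, by linarith⟩)
    refine ⟨w, hw, fun ω hω => ?_, sub_eq_zero.1 hw0⟩
    exact sub_pos.symm.trans (hmono.pos_iff_of_eq_zero hw hω hw0)
  refine ⟨?_, interior⟩
  rcases lt_or_ge m 0 with hm | hm₀
  · refine ⟨-1, fun ω hω => iff_of_true ?_ (by linarith [hω.1])⟩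
    have := hmono.monotoneOn mem0 hω hω.1
    linarith
  rcases lt_or_ge m (1 - ε) with hm₁ | hm₁
  · obtain ⟨w, -, hw, -⟩ := interior hm₀ hm₁
    exact ⟨w, hw⟩
  · refine ⟨1, fun ω hω => iff_of_false ?_ (not_lt.2 hω.2)⟩
    have := hmono.monotoneOn hω mem1 hω.2
    linarith
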